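/- Every set function Ŝ with Ŝ(∅)=0 can be written as a difference Ŝ = Ŝ₁ - Ŝ₂ of two submodular set functions Ŝ₁, Ŝ₂ with Ŝ₁(∅)=Ŝ₂(∅)=0. -/

import Mathlib

open Finset

noncomputable def sortedVal {n : ℕ} (f : Fin n → ℝ) : Fin n → ℝ := f ∘ Tuple.sort f

noncomputable def thresholdSet {n : ℕ} (f : Fin n → ℝ) (i : Fin n) : Finset (Fin n) :=
  Finset.univ.filter (fun j => sortedVal f i ≤ f j)

noncomputable def lovasz {n : ℕ} (R : Finset (Fin n) → ℝ) (f : Fin n → ℝ) : ℝ :=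
  (∑ i : Fin n, if h : (i : ℕ) + 1 < n then
      R (thresholdSet f ⟨(i : ℕ) + 1, h⟩) * (sortedVal f ⟨(i : ℕ) + 1, h⟩ - sortedVal f i)
    else 0)
  + R Finset.univ * (if h : 0 < n then sortedVal f ⟨0, h⟩ else 0)

def Submodular {α : Type*} [DecidableEq α] (R : Finset α → ℝ) : Prop :=
  ∀ A B : Finset α, R (A ∪ B) + R (A ∩ B) ≤ R A + R B

theorem Finset.card_sq_add_card_sq {α : Type*} [DecidableEq α] (A B : Finset α) :
    ((A ∪ B).card : ℝ) ^ 2 + ((A ∩ B).card : ℝ) ^ 2 =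
      (A.card : ℝ) ^ 2 + (B.card : ℝ) ^ 2 + 2 * ((A \ B).card * (B \ A).card) := by
  have h₁ : ((A ∪ B).card : ℝ) + (A ∩ B).card = A.card + B.card := by
    exact_mod_cast card_union_add_card_inter A B
  have h₂ : ((A \ B).card : ℝ) + (A ∩ B).card = A.card := by
    exact_mod_cast card_sdiff_add_card_inter A B
  have h₃ : ((B \ A).card : ℝ) + (A ∩ B).card = B.card := by
    rw [inter_comm]
    exact_mod_cast card_sdiff_add_card_inter B A
  rw [← h₂, ← h₃] at h₁ ⊢
  rw [eq_sub_of_add_eq h₁]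
  ring

theorem submodular_neg_mul_card_sq {α : Type*} [DecidableEq α] {c : ℝ} (hc : 0 ≤ c) :
    Submodular fun A : Finset α => -(c * (A.card : ℝ) ^ 2) := by
  intro A B
  have h : 0 ≤ c * (2 * (((A \ B).card : ℝ) * (B \ A).card)) := by positivity
  linear_combination h - c * card_sq_add_card_sq A B

theorem submodular_sub_mul_card_sq {α : Type*} [DecidableEq α] {S : Finset α → ℝ} {M : ℝ}
    (hM : ∀ A, |S A| ≤ M) : Submodular fun A => S A - 2 * M * (A.card : ℝ) ^ 2 := by
  intro A B
  by_cases hAB : A ⊆ B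
  · simp only [union_eq_right.2 hAB, inter_eq_left.2 hAB]
    linarith
  by_cases hBA : B ⊆ A
  · simp only [union_eq_left.2 hBA, inter_eq_right.2 hBA]
    linarith
  have h₁ : (1 : ℝ) ≤ (A \ B).card * (B \ A).card := by
    exact_mod_cast Nat.mul_pos (card_pos.2 (sdiff_nonempty.2 hAB))
      (card_pos.2 (sdiff_nonempty.2 hBA))
  have hM₀ : 0 ≤ M := (abs_nonneg _).trans (hM A)
  have h₂ := mul_le_mul_of_nonneg_left h₁ hM₀
  have hU := (abs_le.1 (hM (A ∪ B))).2
  have hI := (abs_le.1 (hM (A ∩ B))).2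
  have hA := (abs_le.1 (hM A)).1
  have hB := (abs_le.1 (hM B)).1
  linear_combination hU + hI + hA + hB + 4 * h₂ - 2 * M * card_sq_add_card_sq A B

/-- every set function vanishing on ∅ is a difference of two
submodular set functions vanishing on ∅. -/
theorem setfun_diff_submodular {α : Type*} [Fintype α] [DecidableEq α]
    (S : Finset α → ℝ) (hS : S ∅ = 0) :
    ∃ S₁ S₂ : Finset α → ℝ, Submodular S₁ ∧ Submodular S₂ ∧
      S₁ ∅ = 0 ∧ S₂ ∅ = 0 ∧ ∀ A : Finset α, S A = S₁ A - S₂ A := by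
  have hM : ∀ A, |S A| ≤ ∑ B, |S B| := fun A =>
    single_le_sum (f := fun B => |S B|) (fun _ _ => abs_nonneg _) (mem_univ A)
  have hM₀ : 0 ≤ 2 * ∑ B, |S B| := by positivity
  exact ⟨_, _, submodular_sub_mul_card_sq hM, submodular_neg_mul_card_sq hM₀,
    by simp [hS], by simp, fun A => by ring⟩
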